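/- For any ε > 0, ∫_1^y ε(u) du = (B/2) y + O(y^{1/2+ε}) as y → ∞, where B = −C₀ − log 2π and C₀ is Euler's constant. -/

import Mathlib

open Real MeasureTheory

/-- The singular series of the twin prime / Goldbach type problems. -/
noncomputable def singularSeries (d : ℕ) : ℝ :=
  if Even d then
    2 * (∏' p : Nat.Primes, if 2 < (p : ℕ) then (1 - 1 / ((p : ℝ) - 1) ^ 2) else 1) *
      ∏ p ∈ d.primeFactors.filter (fun p => 2 < p), ((p : ℝ) - 1) / ((p : ℝ) - 2)
  else 0

/-- The constant `B = -C₀ - log 2π`. -/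
noncomputable def Bconst : ℝ := -Real.eulerMascheroniConstant - Real.log (2 * Real.pi)

/-- `ε(y) = Σ_{h ≤ y} 𝔖(h) - y + (1/2) log y`. -/
noncomputable def epsErr (y : ℝ) : ℝ :=
  (∑ h ∈ Finset.Icc 1 ⌊y⌋₊, singularSeries h) - y + Real.log y / 2

/-- `f(y) = ∫_1^y (ε(u) - B/2) du`. -/
noncomputable def fErr (y : ℝ) : ℝ := ∫ u in (1 : ℝ)..y, (epsErr u - Bconst / 2)

section ClassicalAsymptotics

open Filter Topology Finset

/-- A convergent sequence whose increments are dominated by those of a null sequence `b`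
approximates its limit to within `b`. -/
lemma abs_sub_le_of_tendsto_of_abs_sub_le {a b : ℕ → ℝ} {L : ℝ}
    (ha : Tendsto a atTop (𝓝 L)) (hb : Tendsto b atTop (𝓝 0))
    (h : ∀ n, 1 ≤ n → |a (n + 1) - a n| ≤ b n - b (n + 1)) {n : ℕ} (hn : 1 ≤ n) :
    |a n - L| ≤ b n := by
  have key : ∀ m, n ≤ m → |a n - a m| ≤ b n - b m := by
    intro m hm
    induction m, hm using Nat.le_induction with
    | base => simp
    | succ m hm ih =>
      have h1 := h m (hn.trans hm)
      have h2 := abs_sub_le (a n) (a m) (a (m + 1))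
      rw [abs_sub_comm (a m)] at h2
      linarith
  have h1 : Tendsto (fun m => |a n - a m|) atTop (𝓝 |a n - L|) := (ha.const_sub _).abs
  have h2 : Tendsto (fun m => b n - b m) atTop (𝓝 (b n - 0)) := hb.const_sub _
  rw [sub_zero] at h2
  exact le_of_tendsto_of_tendsto h1 h2 (eventually_atTop.2 ⟨n, key⟩)

lemma log_le_half_sub_inv {x : ℝ} (hx : 1 ≤ x) : log x ≤ (x - x⁻¹) / 2 := by
  rw [← Real.sinh_log (by linarith)]
  exact Real.self_le_sinh_iff.2 (Real.log_nonneg hx)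

lemma log_succ_sub_log_le {n : ℕ} (hn : 1 ≤ n) :
    log ((n : ℝ) + 1) - log n ≤ (2 * n + 1) / (2 * n * (n + 1)) := by
  have h0 : (0 : ℝ) < n := by exact_mod_cast hn
  rw [← Real.log_div (by positivity) h0.ne']
  refine (log_le_half_sub_inv ((one_le_div h0).2 (by linarith))).trans (le_of_eq ?_)
  field_simp
  ring

lemma le_log_succ_sub_log {n : ℕ} (hn : 1 ≤ n) :
    2 / (2 * (n : ℝ) + 1) ≤ log ((n : ℝ) + 1) - log n := by
  have h0 : (0 : ℝ) < n := by exact_mod_cast hn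
  have h := Real.le_log_one_add_of_nonneg (x := 1 / (n : ℝ)) (by positivity)
  rw [← Real.log_div (by positivity) h0.ne']
  convert h using 1
  · field_simp
    ring
  · congr 1
    field_simp

lemma tendsto_const_div_pow_atTop (c : ℝ) {k : ℕ} (hk : k ≠ 0) :
    Tendsto (fun n : ℕ => c / (n : ℝ) ^ k) atTop (𝓝 0) :=
  tendsto_const_nhds.div_atTop ((tendsto_pow_atTop hk).comp tendsto_natCast_atTop_atTop)

lemma abs_harmonic_sub_le {n : ℕ} (hn : 1 ≤ n) :
    |∑ b ∈ Ioc 0 n, (b : ℝ)⁻¹ - (log n + eulerMascheroniConstant + 1 / (2 * n))|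
      ≤ 1 / (n : ℝ) ^ 2 := by
  have hH : ∀ n : ℕ, (∑ b ∈ Ioc 0 n, (b : ℝ)⁻¹) = (harmonic n : ℝ) := by
    intro n
    rw [harmonic_eq_sum_Icc]
    push_cast
    rfl
  have h := abs_sub_le_of_tendsto_of_abs_sub_le
    (a := fun n : ℕ => ∑ b ∈ Ioc 0 n, (b : ℝ)⁻¹ - log n - (1 / 2) / (n : ℝ) ^ 1)
    (b := fun n : ℕ => 1 / (n : ℝ) ^ 2) (L := eulerMascheroniConstant) ?_
    (tendsto_const_div_pow_atTop 1 two_ne_zero) ?_ hn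
  · convert h using 2
    ring
  · simp_rw [hH]
    simpa using Real.tendsto_harmonic_sub_log.sub
      (tendsto_const_div_pow_atTop (1 / 2) one_ne_zero)
  · intro n hn
    have h0 : (1 : ℝ) ≤ n := by exact_mod_cast hn
    rw [Finset.sum_Ioc_succ_top (Nat.zero_le n)]
    push_cast
    have h1 := log_succ_sub_log_le hn
    have h2 := le_log_succ_sub_log hn
    have e1 : ((n : ℝ) + 1)⁻¹ - (1 / 2) / ((n : ℝ) + 1) ^ 1 + (1 / 2) / (n : ℝ) ^ 1
        = (2 * n + 1) / (2 * n * (n + 1)) := by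
      field_simp
      ring
    have e2 : (2 * (n : ℝ) + 1) / (2 * n * (n + 1)) - 2 / (2 * (n : ℝ) + 1)
        ≤ 1 / (n : ℝ) ^ 2 - 1 / ((n : ℝ) + 1) ^ 2 := by
      rw [div_sub_div _ _ (by positivity) (by positivity),
        div_sub_div _ _ (by positivity) (by positivity),
        div_le_div_iff₀ (by positivity) (by positivity)]
      have : 0 ≤ (n : ℝ) - 1 := by linarith
      obtain ⟨m, hm⟩ : ∃ m : ℝ, (n : ℝ) = m + 1 := ⟨n - 1, by ring⟩
      have hm0 : 0 ≤ m := by linarith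
      rw [hm, ← sub_nonneg]
      ring_nf
      positivity
    have e3 : 1 / ((n : ℝ) + 1) ^ 2 ≤ 1 / (n : ℝ) ^ 2 := by gcongr; linarith
    rw [abs_le]
    constructor <;> linarith

lemma abs_sum_inv_sq_sub_le {n : ℕ} (hn : 1 ≤ n) :
    |∑ b ∈ Ioc 0 n, ((b : ℝ) ^ 2)⁻¹
        - ((∑' b : ℕ, ((b : ℝ) ^ 2)⁻¹) - 1 / n + 1 / (2 * (n : ℝ) ^ 2))|
      ≤ 1 / (n : ℝ) ^ 3 := by
  have hs : Summable (fun b : ℕ => ((b : ℝ) ^ 2)⁻¹) := Real.summable_nat_pow_inv.2 one_lt_two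
  have hS : ∀ n : ℕ, ∑ b ∈ Ioc 0 n, ((b : ℝ) ^ 2)⁻¹ = ∑ b ∈ range (n + 1), ((b : ℝ) ^ 2)⁻¹ := by
    intro n
    rw [Finset.range_eq_Ico, Finset.sum_eq_sum_Ico_succ_bot (Nat.succ_pos n)]
    simp only [Nat.cast_zero, ne_eq, OfNat.ofNat_ne_zero, not_false_eq_true, zero_pow, inv_zero,
      zero_add]
    rfl
  have h := abs_sub_le_of_tendsto_of_abs_sub_le
    (a := fun n : ℕ => ∑ b ∈ Ioc 0 n, ((b : ℝ) ^ 2)⁻¹ + 1 / (n : ℝ) ^ 1 - (1 / 2) / (n : ℝ) ^ 2)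
    (b := fun n : ℕ => 1 / (n : ℝ) ^ 3) (L := ∑' b : ℕ, ((b : ℝ) ^ 2)⁻¹) ?_
    (tendsto_const_div_pow_atTop 1 three_ne_zero) ?_ hn
  · convert h using 2
    ring
  · simp_rw [hS]
    simpa using ((((tendsto_add_atTop_iff_nat 1).2 hs.hasSum.tendsto_sum_nat).add
      (tendsto_const_div_pow_atTop 1 one_ne_zero)).sub
      (tendsto_const_div_pow_atTop (1 / 2) two_ne_zero))
  · intro n hn
    have h0 : (1 : ℝ) ≤ n := by exact_mod_cast hn
    rw [Finset.sum_Ioc_succ_top (Nat.zero_le n)]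
    push_cast
    have e1 : (((n : ℝ) + 1) ^ 2)⁻¹ + 1 / ((n : ℝ) + 1) ^ 1 - (1 / 2) / ((n : ℝ) + 1) ^ 2
        - 1 / (n : ℝ) ^ 1 + (1 / 2) / (n : ℝ) ^ 2 = 1 / (2 * (n : ℝ) ^ 2 * (n + 1) ^ 2) := by
      field_simp
      ring
    have e2 : 1 / (2 * (n : ℝ) ^ 2 * (n + 1) ^ 2) ≤ 1 / (n : ℝ) ^ 3 - 1 / ((n : ℝ) + 1) ^ 3 := by
      rw [div_sub_div _ _ (by positivity) (by positivity),
        div_le_div_iff₀ (by positivity) (by positivity), ← sub_nonneg]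
      ring_nf
      positivity
    have e3 : 0 ≤ 1 / (2 * (n : ℝ) ^ 2 * (n + 1) ^ 2) := by positivity
    rw [abs_le]
    constructor <;> linarith

lemma abs_log_factorial_sub_le {n : ℕ} (hn : 1 ≤ n) :
    |log (n.factorial) - (n * log n - n + log n / 2 + log (2 * π) / 2)| ≤ 1 / (n : ℝ) := by
  have h := abs_sub_le_of_tendsto_of_abs_sub_le
    (a := fun n : ℕ => log (n.factorial) - (n * log n - n + log n / 2))
    (b := fun n : ℕ => 1 / (n : ℝ) ^ 1) (L := log (2 * π) / 2) ?_
    (tendsto_const_div_pow_atTop 1 one_ne_zero) ?_ hn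
  · convert h using 2
    · ring
    · ring
  · have h1 := (Real.continuousAt_log (Real.sqrt_pos.2 Real.pi_pos).ne').tendsto.comp
      Stirling.tendsto_stirlingSeq_sqrt_pi
    have h2 := h1.add_const (log 2 / 2)
    have e : log √π + log 2 / 2 = log (2 * π) / 2 := by
      rw [Real.log_sqrt Real.pi_pos.le, Real.log_mul two_ne_zero Real.pi_ne_zero]
      ring
    rw [e] at h2
    refine h2.congr' (eventually_atTop.2 ⟨1, fun n hn => ?_⟩)
    have h0 : (n : ℝ) ≠ 0 := by positivity
    simp only [Function.comp]
    rw [Stirling.log_stirlingSeq_formula, Real.log_mul two_ne_zero h0,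
      Real.log_div h0 (Real.exp_pos 1).ne', Real.log_exp]
    ring
  · intro n hn
    have h0 : (1 : ℝ) ≤ n := by exact_mod_cast hn
    have h1 := log_succ_sub_log_le hn
    have h2 := le_log_succ_sub_log hn
    rw [Nat.factorial_succ, Nat.cast_mul, Real.log_mul (by positivity) (by positivity)]
    push_cast
    set δ := log ((n : ℝ) + 1) - log n with hδ
    have e0 : log ((n : ℝ) + 1) + log (n.factorial) -
        (((n : ℝ) + 1) * log ((n : ℝ) + 1) - (n + 1) + log ((n : ℝ) + 1) / 2) -
        (log (n.factorial) - (n * log n - n + log n / 2)) = 1 - (n + 1 / 2) * δ := by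
      rw [hδ]; ring
    rw [e0]
    have e1 : 1 ≤ ((n : ℝ) + 1 / 2) * δ := by
      calc (1 : ℝ) = (n + 1 / 2) * (2 / (2 * n + 1)) := by field_simp
        _ ≤ _ := by gcongr
    have e2 : ((n : ℝ) + 1 / 2) * δ ≤ 1 + 1 / (4 * n * (n + 1)) := by
      calc ((n : ℝ) + 1 / 2) * δ ≤ (n + 1 / 2) * ((2 * n + 1) / (2 * n * (n + 1))) := by gcongr
        _ = 1 + 1 / (4 * n * (n + 1)) := by field_simp; ring
    have e3 : 1 / (n : ℝ) ^ 1 - 1 / ((n : ℝ) + 1) ^ 1 = 4 * (1 / (4 * n * (n + 1))) := by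
      field_simp; ring
    have e4 : 0 ≤ 1 / (4 * (n : ℝ) * (n + 1)) := by positivity
    rw [e3, abs_le]
    constructor <;> linarith

end ClassicalAsymptotics

section DivisorTypeSum

open Finset

lemma sum_Ioc_max_zero_eq {g : ℕ → ℝ} {n M : ℕ} (hnM : n ≤ M) (hpos : ∀ k ∈ Ioc 0 n, 0 ≤ g k)
    (hneg : ∀ k, n < k → g k ≤ 0) :
    ∑ k ∈ Ioc 0 M, max 0 (g k) = ∑ k ∈ Ioc 0 n, g k := by
  rw [← Finset.sum_subset (Finset.Ioc_subset_Ioc_right hnM)]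
  · exact Finset.sum_congr rfl fun k hk => max_eq_right (hpos k hk)
  · intro k hk hk'
    simp only [Finset.mem_Ioc] at hk hk'
    exact max_eq_left (hneg k (by lia))

lemma sum_Ioc_cast (n : ℕ) : ∑ k ∈ Ioc 0 n, (k : ℝ) = n * (n + 1) / 2 := by
  induction n with
  | zero => simp
  | succ n ih =>
    rw [Finset.sum_Ioc_succ_top (Nat.zero_le n), ih]
    push_cast
    ring

lemma abs_sum_max_sub_le {X : ℝ} (hX : 0 ≤ X) {M : ℕ} (hM : ⌊X⌋₊ ≤ M) :
    |∑ k ∈ Ioc 0 M, max 0 (X - k) - (X ^ 2 - X) / 2| ≤ 1 / 8 := by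
  have h1 := Nat.floor_le hX
  have h2 := Nat.lt_floor_add_one X
  rw [sum_Ioc_max_zero_eq (g := fun k => X - k) hM]
  · rw [Finset.sum_sub_distrib, sum_Ioc_cast]
    simp only [Finset.sum_const, Nat.card_Ioc, tsub_zero, nsmul_eq_mul]
    set n : ℝ := (⌊X⌋₊ : ℝ)
    obtain ⟨f, hf⟩ : ∃ f, X = n + f := ⟨X - n, by ring⟩
    have hf0 : 0 ≤ f := by linarith
    have hf1 : f ≤ 1 := by linarith
    rw [abs_le, hf]
    constructor <;> nlinarith [sq_nonneg (f - 1 / 2), mul_nonneg hf0 (sub_nonneg.2 hf1)]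
  · intro k hk
    have : (k : ℝ) ≤ ⌊X⌋₊ := by exact_mod_cast (Finset.mem_Ioc.1 hk).2
    linarith
  · intro k hk
    have : (⌊X⌋₊ : ℝ) + 1 ≤ k := by exact_mod_cast hk
    linarith

lemma abs_sum_max_div_sub_le {X : ℝ} (hX : 1 ≤ X) {M : ℕ} (hM : ⌊X⌋₊ ≤ M) :
    |∑ b ∈ Ioc 0 M, max 0 (X / b - 1)
        - (X * log X + (eulerMascheroniConstant - 1) * X + 1 / 2)| ≤ 8 / X := by
  have h1 := Nat.floor_le (zero_le_one.trans hX)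
  have h2 := Nat.lt_floor_add_one X
  have hn : 1 ≤ ⌊X⌋₊ := (Nat.one_le_floor_iff X).2 hX
  have hH := abs_harmonic_sub_le hn
  rw [sum_Ioc_max_zero_eq (g := fun b => X / b - 1) hM]
  · have hsum : ∑ b ∈ Ioc 0 ⌊X⌋₊, (X / b - 1)
        = X * ∑ b ∈ Ioc 0 ⌊X⌋₊, (b : ℝ)⁻¹ - ⌊X⌋₊ := by
      rw [Finset.sum_sub_distrib, Finset.mul_sum]
      simp [div_eq_mul_inv]
    rw [hsum]
    set H := ∑ b ∈ Ioc 0 ⌊X⌋₊, (b : ℝ)⁻¹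
    have hn1 : (1 : ℝ) ≤ ⌊X⌋₊ := by exact_mod_cast hn
    generalize (⌊X⌋₊ : ℝ) = n at *
    have hn0 : 0 < n := by linarith
    obtain ⟨f, hf⟩ : ∃ f, X = n + f := ⟨X - n, by ring⟩
    have hf0 : 0 ≤ f := by linarith
    have hf1 : f ≤ 1 := by linarith
    set e := H - (log n + eulerMascheroniConstant + 1 / (2 * n)) with he
    have hHe : H = log n + eulerMascheroniConstant + 1 / (2 * n) + e := by rw [he]; ring
    set t := f / n with ht
    have hft : f = t * n := by rw [ht]; field_simp
    have ht0 : 0 ≤ t := by positivity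
    have hlog : log X = log n + log (1 + t) := by
      rw [← Real.log_mul hn0.ne' (by positivity), hf, hft]
      ring_nf
    have hl1 : log (1 + t) ≤ t := by
      have := Real.log_le_sub_one_of_pos (x := 1 + t) (by positivity)
      linarith
    have hl2 : t - t ^ 2 / 2 ≤ log (1 + t) := by
      refine le_trans ?_ (Real.le_log_one_add_of_nonneg ht0)
      rw [le_div_iff₀ (by positivity)]
      nlinarith [pow_nonneg ht0 3]
    obtain ⟨d, hd⟩ : ∃ d, log (1 + t) = t - d := ⟨t - log (1 + t), by ring⟩
    have hd0 : 0 ≤ d := by linarith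
    have hd1 : d ≤ t ^ 2 / 2 := by linarith
    have ht1 : t ≤ 1 / n := by rw [ht]; gcongr
    have hX2 : X ≤ 2 * n := by linarith
    have hE : X * H - n - (X * log X + (eulerMascheroniConstant - 1) * X + 1 / 2)
        = X * e + X * d - f * t + t / 2 := by
      rw [hHe, hlog, hd, hf]
      have : t = f / n := ht
      rw [this]
      field_simp
      ring
    rw [hE]
    have b1 : |X * e| ≤ 2 / n := by
      rw [abs_mul, abs_of_pos (by linarith)]
      calc X * |e| ≤ (2 * n) * (1 / n ^ 2) := by gcongr
        _ = 2 / n := by field_simp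
    have b2 : X * d ≤ 1 / n := by
      calc X * d ≤ (2 * n) * ((1 / n) ^ 2 / 2) := by
            gcongr
            exact hd1.trans (by gcongr)
        _ = 1 / n := by field_simp
    have b2' : 0 ≤ X * d := by positivity
    have b3 : f * t ≤ 1 / n := by
      calc f * t ≤ 1 * (1 / n) := by gcongr
        _ = 1 / n := one_mul _
    have b3' : 0 ≤ f * t := by positivity
    have b4 : 4 / n ≤ 8 / X := by
      rw [div_le_div_iff₀ hn0 (by linarith)]
      linarith
    have b5 : 4 / n = 4 * (1 / n) := by ring
    have b6 : 2 / n = 2 * (1 / n) := by ring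
    have := abs_le.1 b1
    rw [abs_le]
    constructor <;> linarith
  · intro b hb
    have hb' := Finset.mem_Ioc.1 hb
    have : (b : ℝ) ≤ ⌊X⌋₊ := by exact_mod_cast hb'.2
    have hb0 : (0 : ℝ) < b := by exact_mod_cast hb'.1
    rw [sub_nonneg, one_le_div hb0]
    linarith
  · intro b hb
    have : (⌊X⌋₊ : ℝ) + 1 ≤ b := by exact_mod_cast hb
    rw [sub_nonpos, div_le_one (by linarith)]
    linarith

/-- Dirichlet's hyperbola method for `∑ (x / b - k)` over the lattice points with `b k ≤ x`. -/
lemma sum_sum_max_eq_hyperbola {x : ℝ} {N M : ℕ} (hN : (N : ℝ) ^ 2 ≤ x)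
    (hN' : x ≤ ((N : ℝ) + 1) ^ 2) (hNM : N ≤ M) :
    ∑ b ∈ Ioc 0 M, ∑ k ∈ Ioc 0 M, max 0 (x / b - k) =
      ∑ b ∈ Ioc 0 N, ∑ k ∈ Ioc 0 M, max 0 (x / b - k) +
      ∑ k ∈ Ioc 0 N, (∑ b ∈ Ioc 0 M, max 0 (x / b - k) - ∑ b ∈ Ioc 0 N, (x / b - k)) := by
  have hsplit : ∀ g : ℕ → ℝ,
      ∑ b ∈ Ioc 0 M, g b = ∑ b ∈ Ioc 0 N, g b + ∑ b ∈ Ioc N M, g b := fun g =>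
    (Finset.sum_Ioc_consecutive g (Nat.zero_le N) hNM).symm
  rw [hsplit, add_right_inj, Finset.sum_comm, hsplit]
  rw [Finset.sum_eq_zero (s := Ioc N M), add_zero]
  · refine Finset.sum_congr rfl fun k hk => ?_
    rw [hsplit, eq_sub_iff_add_eq, add_comm, add_left_inj]
    refine Finset.sum_congr rfl fun b hb => ?_
    simp only [Finset.mem_Ioc] at hk hb
    have hb0 : (0 : ℝ) < b := by exact_mod_cast hb.1
    have hk0 : (0 : ℝ) < k := by exact_mod_cast hk.1
    have hb1 : (b : ℝ) ≤ N := by exact_mod_cast hb.2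
    have hk1 : (k : ℝ) ≤ N := by exact_mod_cast hk.2
    rw [max_eq_right]
    rw [sub_nonneg, le_div_iff₀ hb0]
    nlinarith
  · intro k hk
    refine Finset.sum_eq_zero fun b hb => ?_
    simp only [Finset.mem_Ioc] at hk hb
    have hb1 : (N : ℝ) + 1 ≤ b := by exact_mod_cast hb.1
    have hk1 : (N : ℝ) + 1 ≤ k := by exact_mod_cast hk.1
    have hb0 : (0 : ℝ) < b := by have := Nat.cast_nonneg (α := ℝ) N; linarith
    rw [max_eq_left]
    rw [sub_nonpos, div_le_iff₀ hb0]
    have := Nat.cast_nonneg (α := ℝ) N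
    nlinarith

set_option maxHeartbeats 1000000 in
lemma abs_hyperbola_main_sub_le {x N L l H S F Z γ c : ℝ} (hN : 1 ≤ N) (hx : N ^ 2 ≤ x)
    (hx' : x ≤ (N + 1) ^ 2) (hL : L = log N) (hl : l = log x)
    (hH : |H - (L + γ + 1 / (2 * N))| ≤ 1 / N ^ 2)
    (hS : |S - (Z - 1 / N + 1 / (2 * N ^ 2))| ≤ 1 / N ^ 3)
    (hF : |F - (N * L - N + L / 2 + c / 2)| ≤ 1 / N) :
    |(x ^ 2 * S - x * H) / 2 + (N * (x * l) - x * F + N * ((γ - 1) * x) + N * (N + 1) / 2 / 2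
        - N * (x * H) + N * (N + 1) / 2 * N)
      - (Z * x ^ 2 / 2 - x * l / 2 + (1 - γ - c) / 2 * x)| ≤ 100 * N := by
  have hN0 : 0 < N := by linarith
  set e₁ := H - (L + γ + 1 / (2 * N)) with he₁
  set e₂ := S - (Z - 1 / N + 1 / (2 * N ^ 2)) with he₂
  set e₃ := F - (N * L - N + L / 2 + c / 2) with he₃
  have hH' : H = L + γ + 1 / (2 * N) + e₁ := by rw [he₁]; ring
  have hS' : S = Z - 1 / N + 1 / (2 * N ^ 2) + e₂ := by rw [he₂]; ring
  have hF' : F = N * L - N + L / 2 + c / 2 + e₃ := by rw [he₃]; ring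
  obtain ⟨r, hr⟩ : ∃ r, x = N ^ 2 + r := ⟨x - N ^ 2, by ring⟩
  have hr0 : 0 ≤ r := by linarith
  have hr1 : r ≤ 3 * N := by nlinarith
  set t := r / N ^ 2 with ht
  have hrt : r = t * N ^ 2 := by rw [ht]; field_simp
  have ht0 : 0 ≤ t := by positivity
  have ht1 : t ≤ 3 / N := by
    rw [ht, div_le_div_iff₀ (by positivity) hN0]
    nlinarith
  have hlog : l = 2 * L + log (1 + t) := by
    have : 2 * L = log (N ^ 2) := by rw [hL, Real.log_pow]; norm_num
    rw [this, hl, ← Real.log_mul (by positivity) (by positivity), hr, hrt]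
    ring_nf
  have hl1 : log (1 + t) ≤ t := by
    have := Real.log_le_sub_one_of_pos (x := 1 + t) (by positivity)
    linarith
  have hl2 : t - t ^ 2 / 2 ≤ log (1 + t) := by
    refine le_trans ?_ (Real.le_log_one_add_of_nonneg ht0)
    rw [le_div_iff₀ (by positivity)]
    nlinarith [pow_nonneg ht0 3]
  obtain ⟨d, hd⟩ : ∃ d, log (1 + t) = t - d := ⟨t - log (1 + t), by ring⟩
  have hd0 : 0 ≤ d := by linarith
  have hd1 : d ≤ t ^ 2 / 2 := by linarith
  have hd2 : d ≤ 9 / (2 * N ^ 2) := by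
    calc d ≤ (3 / N) ^ 2 / 2 := hd1.trans (by gcongr)
      _ = 9 / (2 * N ^ 2) := by field_simp; norm_num
  have hE : (x ^ 2 * S - x * H) / 2 + (N * (x * l) - x * F + N * ((γ - 1) * x)
        + N * (N + 1) / 2 / 2 - N * (x * H) + N * (N + 1) / 2 * N)
      - (Z * x ^ 2 / 2 - x * l / 2 + (1 - γ - c) / 2 * x)
      = r ^ 2 / (2 * N) + 3 * r ^ 2 / (4 * N ^ 2) - r / (4 * N)
        + x ^ 2 / 2 * e₂ - (1 / 2 + N) * x * e₁ - x * e₃ - (N + 1 / 2) * x * d := by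
    rw [hH', hS', hF', hlog, hd, ht, hr]
    field_simp
    ring
  have hx0 : 0 ≤ x := (sq_nonneg N).trans hx
  have hr2 : r ^ 2 ≤ 9 * N ^ 2 := by
    calc r ^ 2 ≤ (3 * N) ^ 2 := by gcongr
      _ = 9 * N ^ 2 := by ring
  have hNN : N ≤ N ^ 2 := le_self_pow₀ hN two_ne_zero
  have hx4 : x ≤ 4 * N ^ 2 := by linarith
  have b1 : r ^ 2 / (2 * N) ≤ 9 / 2 * N := by
    rw [div_le_iff₀ (by positivity)]
    linarith
  have b1' : 0 ≤ r ^ 2 / (2 * N) := by positivity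
  have b2 : 3 * r ^ 2 / (4 * N ^ 2) ≤ 7 * N := by
    rw [div_le_iff₀ (by positivity)]
    have : N ^ 2 ≤ N * N ^ 2 := le_mul_of_one_le_left (by positivity) hN
    linarith
  have b2' : 0 ≤ 3 * r ^ 2 / (4 * N ^ 2) := by positivity
  have b3 : r / (4 * N) ≤ N := by
    rw [div_le_iff₀ (by positivity)]
    linarith
  have b3' : 0 ≤ r / (4 * N) := by positivity
  have b4 : |x ^ 2 / 2 * e₂| ≤ 8 * N := by
    rw [abs_mul, abs_of_nonneg (by positivity)]
    calc x ^ 2 / 2 * |e₂| ≤ (4 * N ^ 2) ^ 2 / 2 * (1 / N ^ 3) := by gcongr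
      _ = 8 * N := by field_simp; norm_num
  have hN12 : 1 / 2 + N ≤ 2 * N := by linarith
  have b5 : |(1 / 2 + N) * x * e₁| ≤ 8 * N := by
    rw [abs_mul, abs_of_nonneg (by positivity)]
    calc (1 / 2 + N) * x * |e₁| ≤ 2 * N * (4 * N ^ 2) * (1 / N ^ 2) := by gcongr
      _ = 8 * N := by field_simp; norm_num
  have b6 : |x * e₃| ≤ 4 * N := by
    rw [abs_mul, abs_of_nonneg (by positivity)]
    calc x * |e₃| ≤ (4 * N ^ 2) * (1 / N) := by gcongr
      _ = 4 * N := by field_simp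
  have b7 : (N + 1 / 2) * x * d ≤ 36 * N := by
    calc (N + 1 / 2) * x * d ≤ 2 * N * (4 * N ^ 2) * (9 / (2 * N ^ 2)) := by
          gcongr
          linarith
      _ = 36 * N := by field_simp; norm_num
  have b7' : 0 ≤ (N + 1 / 2) * x * d := by positivity
  rw [hE]
  rw [abs_le] at b4 b5 b6 ⊢
  constructor <;> linarith

lemma abs_sum_sum_max_sub_le {x : ℝ} (hx : 1 ≤ x) {M : ℕ} (hM : ⌊x⌋₊ ≤ M) :
    |∑ b ∈ Ioc 0 M, ∑ k ∈ Ioc 0 M, max 0 (x / b - k)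
        - ((∑' b : ℕ, ((b : ℝ) ^ 2)⁻¹) * x ^ 2 / 2 - x * log x / 2
          + (1 - eulerMascheroniConstant - log (2 * π)) / 2 * x)| ≤ 120 * √x := by
  have hx0 : 0 ≤ x := zero_le_one.trans hx
  set N := ⌊√x⌋₊ with hNdef
  have hNs : (N : ℝ) ≤ √x := Nat.floor_le (Real.sqrt_nonneg x)
  have hsN : √x ≤ N + 1 := (Nat.lt_floor_add_one _).le
  have hN1 : 1 ≤ N := (Nat.one_le_floor_iff _).2 (Real.one_le_sqrt.2 hx)
  have hN1' : (1 : ℝ) ≤ N := by exact_mod_cast hN1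
  have hNx : (N : ℝ) ^ 2 ≤ x := by
    rw [← Real.sq_sqrt hx0]; gcongr
  have hxN : x ≤ ((N : ℝ) + 1) ^ 2 := by
    nth_rewrite 1 [← Real.sq_sqrt hx0]; gcongr
  have hNM : N ≤ M := by
    refine le_trans (Nat.le_floor ?_) hM
    nlinarith
  have hdiv : ∀ b ∈ Ioc 0 N, ⌊x / b⌋₊ ≤ M := by
    intro b hb
    have hb1 : (1 : ℝ) ≤ b := by exact_mod_cast (Finset.mem_Ioc.1 hb).1
    exact (Nat.floor_le_floor (div_le_self hx0 hb1)).trans hM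
  rw [sum_sum_max_eq_hyperbola hNx hxN hNM]
  have h1 : |∑ b ∈ Ioc 0 N, (∑ k ∈ Ioc 0 M, max 0 (x / b - k) - ((x / b) ^ 2 - x / b) / 2)|
      ≤ (N : ℝ) := by
    refine (Finset.abs_sum_le_sum_abs _ _).trans ?_
    calc _ ≤ ∑ b ∈ Ioc 0 N, (1 : ℝ) := Finset.sum_le_sum fun b hb =>
          (abs_sum_max_sub_le (by positivity) (hdiv b hb)).trans (by norm_num)
      _ = N := by simp
  have h2 : |∑ k ∈ Ioc 0 N, (∑ b ∈ Ioc 0 M, max 0 (x / b - k)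
      - (x * log x - x * log k + (eulerMascheroniConstant - 1) * x + k / 2))| ≤ 8 * N := by
    refine (Finset.abs_sum_le_sum_abs _ _).trans ?_
    calc _ ≤ ∑ k ∈ Ioc 0 N, (8 : ℝ) := Finset.sum_le_sum fun k hk => ?_
      _ = 8 * N := by simp [mul_comm]
    have hk := Finset.mem_Ioc.1 hk
    have hk0 : (0 : ℝ) < k := by exact_mod_cast hk.1
    have hkN : (k : ℝ) ≤ N := by exact_mod_cast hk.2
    have hkx : 1 ≤ x / k := by
      rw [one_le_div hk0]; nlinarith
    have h := abs_sum_max_div_sub_le hkx (hdiv k (Finset.mem_Ioc.2 hk))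
    have e : ∑ b ∈ Ioc 0 M, max 0 (x / b - k)
        - (x * log x - x * log k + (eulerMascheroniConstant - 1) * x + k / 2)
        = k * (∑ b ∈ Ioc 0 M, max 0 (x / k / b - 1)
          - (x / k * log (x / k) + (eulerMascheroniConstant - 1) * (x / k) + 1 / 2)) := by
      rw [mul_sub, Finset.mul_sum, Real.log_div (by positivity) hk0.ne']
      congr 1
      · refine Finset.sum_congr rfl fun b _ => ?_
        rw [mul_max_of_nonneg _ _ hk0.le, mul_zero, mul_sub, mul_one]
        congr 2
        field_simp
      · field_simp
    rw [e, abs_mul, abs_of_pos hk0]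
    calc (k : ℝ) * _ ≤ k * (8 / (x / k)) := by gcongr
      _ = 8 * (k ^ 2 / x) := by field_simp
      _ ≤ 8 * 1 := by
        gcongr
        rw [div_le_one (by positivity)]
        nlinarith
      _ = 8 := by norm_num
  have h3 := abs_hyperbola_main_sub_le (x := x) (N := N) (Z := ∑' b : ℕ, ((b : ℝ) ^ 2)⁻¹)
    hN1' hNx hxN rfl rfl (abs_harmonic_sub_le hN1) (abs_sum_inv_sq_sub_le hN1)
    (abs_log_factorial_sub_le hN1)
  have s1 : ∑ b ∈ Ioc 0 N, ((x / b) ^ 2 - x / b) / 2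
      = (x ^ 2 * ∑ b ∈ Ioc 0 N, ((b : ℝ) ^ 2)⁻¹ - x * ∑ b ∈ Ioc 0 N, (b : ℝ)⁻¹) / 2 := by
    rw [← Finset.sum_div, Finset.sum_sub_distrib, Finset.mul_sum, Finset.mul_sum]
    simp only [div_eq_mul_inv, mul_pow, inv_pow]
  have s2 : ∑ k ∈ Ioc 0 N, log (k : ℝ) = log (N.factorial) := by
    clear * -
    induction N with
    | zero => simp
    | succ n ih =>
      rw [Finset.sum_Ioc_succ_top (Nat.zero_le n), ih, Nat.factorial_succ, Nat.cast_mul,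
        Real.log_mul (by positivity) (by positivity), add_comm]
  have s3 : ∑ k ∈ Ioc 0 N, (x * log x - x * log k + (eulerMascheroniConstant - 1) * x
        + (k : ℝ) / 2)
      = N * (x * log x) - x * log (N.factorial) + N * ((eulerMascheroniConstant - 1) * x)
        + N * (N + 1) / 2 / 2 := by
    rw [Finset.sum_add_distrib, Finset.sum_add_distrib, Finset.sum_sub_distrib,
      ← Finset.mul_sum (Ioc 0 N) (fun k : ℕ => log (k : ℝ)), s2, ← Finset.sum_div, sum_Ioc_cast]
    simp
  have s4 : ∑ k ∈ Ioc 0 N, ∑ b ∈ Ioc 0 N, (x / b - (k : ℝ))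
      = N * (x * ∑ b ∈ Ioc 0 N, (b : ℝ)⁻¹) - N * (N + 1) / 2 * N := by
    simp_rw [Finset.sum_sub_distrib, div_eq_mul_inv, ← Finset.mul_sum]
    simp only [sum_const, Nat.card_Ioc, tsub_zero, nsmul_eq_mul, ← Finset.mul_sum, sum_Ioc_cast]
    ring
  rw [Finset.sum_sub_distrib] at h1 h2
  rw [Finset.sum_sub_distrib, s4]
  rw [s1] at h1
  rw [s3] at h2
  rw [abs_le] at h1 h2 h3 ⊢
  constructor <;> linarith

end DivisorTypeSum

section SingularSeriesKernel

open Finset ArithmeticFunction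

/-- The arithmetic function `n ↦ 1 / n`. -/
noncomputable def invId : ArithmeticFunction ℝ := ⟨fun n => (n : ℝ)⁻¹, by simp⟩

lemma invId_apply (n : ℕ) : invId n = (n : ℝ)⁻¹ := rfl

lemma isMultiplicative_invId : invId.IsMultiplicative :=
  ⟨by simp [invId_apply], fun _ => by simp [invId_apply, mul_comm]⟩

/-- The multiplicative part of the singular series: `∏ (p - 1) / (p - 2)` over odd primes
dividing `n`. -/
noncomputable def singularFactor : ArithmeticFunction ℝ :=
  prodPrimeFactors fun p => if 2 < p then ((p : ℝ) - 1) / (p - 2) else 1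

/-- The Dirichlet quotient of `singularFactor` by `n ↦ ∑ d ∣ n, 1 / d`. -/
noncomputable def singularKernel : ArithmeticFunction ℝ :=
  (pmul (ArithmeticFunction.moebius : ArithmeticFunction ℝ) invId) *
    ((ArithmeticFunction.moebius : ArithmeticFunction ℝ) * singularFactor)

lemma isMultiplicative_singularFactor : singularFactor.IsMultiplicative :=
  IsMultiplicative.prodPrimeFactors _

lemma isMultiplicative_singularKernel : singularKernel.IsMultiplicative :=
  (isMultiplicative_moebius.intCast.pmul isMultiplicative_invId).mul
    (isMultiplicative_moebius.intCast.mul isMultiplicative_singularFactor)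

lemma moebius_pmul_invId_mul_invId :
    (pmul (ArithmeticFunction.moebius : ArithmeticFunction ℝ) invId) * invId = 1 := by
  ext n
  have h : ((ArithmeticFunction.moebius : ArithmeticFunction ℝ) *
      (ArithmeticFunction.zeta : ArithmeticFunction ℝ)) n = (1 : ArithmeticFunction ℝ) n := by
    rw [coe_moebius_mul_coe_zeta]
  have e : ((pmul (ArithmeticFunction.moebius : ArithmeticFunction ℝ) invId) * invId) n
      = (n : ℝ)⁻¹ * ((ArithmeticFunction.moebius : ArithmeticFunction ℝ) *
      (ArithmeticFunction.zeta : ArithmeticFunction ℝ)) n := by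
    rw [mul_apply, mul_apply, Finset.mul_sum]
    refine Finset.sum_congr rfl fun x hx => ?_
    obtain ⟨h1, h2⟩ := Nat.mem_divisorsAntidiagonal.1 hx
    have hx2 : x.2 ≠ 0 := by rintro h0; simp [h0] at h1; exact h2 h1.symm
    rw [pmul_apply, invId_apply, invId_apply, natCoe_apply, zeta_apply_ne hx2, ← h1]
    push_cast
    rw [mul_inv]
    ring
  rw [e, h, one_apply]
  split_ifs with h1
  · simp [h1]
  · simp

lemma singularKernel_mul_invId :
    singularKernel * invId = (ArithmeticFunction.moebius : ArithmeticFunction ℝ) *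
      singularFactor := by
  rw [singularKernel, mul_right_comm, moebius_pmul_invId_mul_invId, one_mul]

lemma singularKernel_mul_eq :
    singularKernel * (invId * (ArithmeticFunction.zeta : ArithmeticFunction ℝ))
      = singularFactor := by
  rw [← mul_assoc, singularKernel_mul_invId, mul_right_comm, coe_moebius_mul_coe_zeta, one_mul]

lemma mul_apply_prime_pow_succ {R : Type*} [CommSemiring R] (F B : ArithmeticFunction R)
    (hB1 : B 1 = 1) {p : ℕ} (hp : p.Prime) (hB : ∀ k, B (p ^ (k + 1)) = B p * B (p ^ k)) (k : ℕ) :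
    (F * B) (p ^ (k + 1)) = F (p ^ (k + 1)) + B p * (F * B) (p ^ k) := by
  have key : ∀ k, (F * B) (p ^ k) = ∑ i ∈ range (k + 1), F (p ^ i) * B (p ^ (k - i)) := by
    intro k
    rw [mul_apply, Nat.sum_divisorsAntidiagonal (fun a b => F a * B b),
      Nat.sum_divisors_prime_pow hp]
    refine Finset.sum_congr rfl fun i hi => ?_
    rw [Nat.pow_div (Nat.lt_succ_iff.1 (Finset.mem_range.1 hi)) hp.pos]
  rw [key, key, Finset.sum_range_succ, Nat.sub_self, pow_zero, hB1, mul_one, add_comm,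
    Finset.mul_sum]
  congr 1
  refine Finset.sum_congr rfl fun i hi => ?_
  rw [Nat.succ_sub (Nat.lt_succ_iff.1 (Finset.mem_range.1 hi)), hB]
  ring

lemma singularFactor_prime_pow_succ {p : ℕ} (hp : p.Prime) (k : ℕ) :
    singularFactor (p ^ (k + 1)) = if 2 < p then ((p : ℝ) - 1) / (p - 2) else 1 := by
  rw [singularFactor, prodPrimeFactors_apply (pow_ne_zero _ hp.ne_zero),
    Nat.primeFactors_prime_pow k.succ_ne_zero hp, Finset.prod_singleton]

lemma moebius_mul_singularFactor_prime_pow_succ {p : ℕ} (hp : p.Prime) (k : ℕ) :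
    ((ArithmeticFunction.moebius : ArithmeticFunction ℝ) * singularFactor) (p ^ (k + 1))
      = singularFactor (p ^ (k + 1)) - singularFactor (p ^ k) := by
  have h := mul_apply_prime_pow_succ
    ((ArithmeticFunction.moebius : ArithmeticFunction ℝ) * singularFactor)
    (ArithmeticFunction.zeta : ArithmeticFunction ℝ) (by simp) hp
    (fun k => by simp [natCoe_apply, zeta_apply, hp.ne_zero]) k
  rw [mul_right_comm, coe_moebius_mul_coe_zeta, one_mul] at h
  rw [h]
  simp [natCoe_apply, zeta_apply, hp.ne_zero]

lemma singularKernel_prime_pow_succ {p : ℕ} (hp : p.Prime) (k : ℕ) :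
    singularKernel (p ^ (k + 1)) =
      ((ArithmeticFunction.moebius : ArithmeticFunction ℝ) * singularFactor) (p ^ (k + 1))
      - (p : ℝ)⁻¹ *
        ((ArithmeticFunction.moebius : ArithmeticFunction ℝ) * singularFactor) (p ^ k) := by
  have h := mul_apply_prime_pow_succ singularKernel invId (by simp [invId_apply]) hp
    (fun k => by simp [invId_apply, pow_succ, mul_comm]) k
  rw [singularKernel_mul_invId, invId_apply] at h
  rw [h]
  ring

lemma singularKernel_one : singularKernel 1 = 1 := isMultiplicative_singularKernel.1

lemma singularKernel_prime {p : ℕ} (hp : p.Prime) :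
    singularKernel p = if 2 < p then 2 / ((p : ℝ) * (p - 2)) else -1 / 2 := by
  have h := singularKernel_prime_pow_succ hp 0
  rw [moebius_mul_singularFactor_prime_pow_succ hp, singularFactor_prime_pow_succ hp, pow_zero,
    isMultiplicative_singularFactor.1, (isMultiplicative_moebius.intCast.mul
    isMultiplicative_singularFactor).1, zero_add, pow_one] at h
  rw [h]
  split_ifs with h2
  · have h2' : (2 : ℝ) < p := by exact_mod_cast h2
    have h3 : (p : ℝ) - 2 ≠ 0 := by linarith
    field_simp
    ring
  · have : p = 2 := le_antisymm (not_lt.1 h2) hp.two_le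
    subst this
    norm_num

lemma singularKernel_prime_sq {p : ℕ} (hp : p.Prime) :
    singularKernel (p ^ 2) = if 2 < p then -1 / ((p : ℝ) * (p - 2)) else 0 := by
  have h := singularKernel_prime_pow_succ hp 1
  rw [moebius_mul_singularFactor_prime_pow_succ hp, singularFactor_prime_pow_succ hp,
    singularFactor_prime_pow_succ hp 0,
    moebius_mul_singularFactor_prime_pow_succ hp 0, singularFactor_prime_pow_succ hp, pow_zero,
    isMultiplicative_singularFactor.1] at h
  rw [h]
  split_ifs with h2
  · have h2' : (2 : ℝ) < p := by exact_mod_cast h2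
    have h3 : (p : ℝ) - 2 ≠ 0 := by linarith
    field_simp
    ring
  · simp

lemma singularKernel_prime_pow_eq_zero {p : ℕ} (hp : p.Prime) {k : ℕ} (hk : 3 ≤ k) :
    singularKernel (p ^ k) = 0 := by
  obtain ⟨j, rfl⟩ : ∃ j, k = j + 1 + 1 + 1 := ⟨k - 3, by lia⟩
  rw [singularKernel_prime_pow_succ hp, moebius_mul_singularFactor_prime_pow_succ hp,
    moebius_mul_singularFactor_prime_pow_succ hp]
  simp only [singularFactor_prime_pow_succ hp]
  ring

/-- A nonnegative multiplicative function is summable if its Euler factors are `1 + O(c p)` for a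
summable `c`. -/
lemma summable_of_multiplicative_of_le {w c : ℕ → ℝ} {v : ℕ → ℝ} (h0 : w 0 = 0) (h1 : w 1 = 1)
    (hmul : ∀ {m n : ℕ}, m.Coprime n → w (m * n) = w m * w n) (hw : ∀ n, 0 ≤ w n)
    (hc : Summable c) (hc0 : ∀ n, 0 ≤ c n)
    (hv : ∀ {p : ℕ}, p.Prime → HasSum (fun k => w (p ^ k)) (v p))
    (hvc : ∀ p : ℕ, p.Prime → v p ≤ 1 + c p) : Summable w := by
  refine summable_of_sum_le hw (c := Real.exp (∑' n, c n)) fun s => ?_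
  set N := s.sup id + 1 with hN
  have h := (EulerProduct.summable_and_hasSum_smoothNumbers_prod_primesBelow_tsum h1 hmul
    (fun hp => (hv hp).summable.norm) N).2
  have h' : HasSum (Set.indicator (Nat.smoothNumbers N) w)
      (∏ p ∈ N.primesBelow, ∑' k : ℕ, w (p ^ k)) := hasSum_subtype_iff_indicator.1 h
  calc ∑ n ∈ s, w n ≤ ∑ n ∈ s, Set.indicator (Nat.smoothNumbers N) w n := by
        refine Finset.sum_le_sum fun n hn => ?_
        rcases Nat.eq_zero_or_pos n with rfl | hn0
        · rw [h0]
          exact Set.indicator_nonneg (fun n _ => hw n) _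
        · rw [Set.indicator_of_mem]
          exact Nat.mem_smoothNumbers_of_lt hn0
            (Nat.lt_succ_of_le (Finset.le_sup (f := id) hn))
    _ ≤ ∏ p ∈ N.primesBelow, ∑' k : ℕ, w (p ^ k) :=
        sum_le_hasSum _ (fun n _ => Set.indicator_nonneg (fun n _ => hw n) _) h'
    _ ≤ ∏ p ∈ N.primesBelow, Real.exp (c p) := by
        refine Finset.prod_le_prod (fun p _ => tsum_nonneg fun k => hw _) fun p hp => ?_
        have hp' := Nat.prime_of_mem_primesBelow hp
        rw [(hv hp').tsum_eq]
        refine (hvc p hp').trans ?_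
        rw [add_comm]
        exact Real.add_one_le_exp _
    _ = Real.exp (∑ p ∈ N.primesBelow, c p) := (Real.exp_sum _ _).symm
    _ ≤ _ := Real.exp_le_exp.2 (hc.sum_le_tsum _ fun n _ => hc0 n)

lemma hasSum_prime_pow_of_eq_zero {w : ℕ → ℝ} {p : ℕ} (h : ∀ k, 3 ≤ k → w (p ^ k) = 0) :
    HasSum (fun k => w (p ^ k)) (w 1 + w p + w (p ^ 2)) := by
  have : HasSum (fun k => w (p ^ k)) (∑ k ∈ range 3, w (p ^ k)) :=
    hasSum_sum_of_ne_finset_zero fun k hk => h k (by simpa using hk)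
  simpa [Finset.sum_range_succ] using this

lemma summable_abs_singularKernel_mul_rpow {θ : ℝ} (hθ : 1 / 2 < θ) (hθ1 : θ < 1) :
    Summable fun n : ℕ => |singularKernel n| * (n : ℝ) ^ (1 - θ) := by
  refine summable_of_multiplicative_of_le (c := fun n : ℕ => 9 * ((n : ℝ) ^ (2 * θ))⁻¹)
    (v := fun p => |singularKernel 1| * ((1 : ℕ) : ℝ) ^ (1 - θ)
      + |singularKernel p| * (p : ℝ) ^ (1 - θ)
      + |singularKernel (p ^ 2)| * ((p ^ 2 : ℕ) : ℝ) ^ (1 - θ)) ?_ ?_ ?_ ?_ ?_ ?_ ?_ ?_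
  · simp
  · simp [singularKernel_one]
  · intro m n hmn
    rw [isMultiplicative_singularKernel.2 hmn, abs_mul, Nat.cast_mul,
      Real.mul_rpow (by positivity) (by positivity)]
    ring
  · intro n
    positivity
  · exact (Real.summable_nat_rpow_inv.2 (by linarith)).mul_left 9
  · intro n
    positivity
  · intro p hp
    exact hasSum_prime_pow_of_eq_zero
      (w := fun n : ℕ => |singularKernel n| * (n : ℝ) ^ (1 - θ)) fun k hk => by
        simp [singularKernel_prime_pow_eq_zero hp hk]
  · intro p hp
    have hp2 : (2 : ℝ) ≤ p := by exact_mod_cast hp.two_le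
    have hp0 : (0 : ℝ) < p := by linarith
    rw [singularKernel_one, singularKernel_prime hp, singularKernel_prime_sq hp]
    simp only [abs_one, Nat.cast_one, Real.one_rpow, mul_one]
    rw [add_assoc, add_le_add_iff_left]
    have e1 : ((p : ℝ) ^ (2 * θ))⁻¹ = (p : ℝ) ^ (-(2 * θ)) := (Real.rpow_neg hp0.le _).symm
    have e2 : (p : ℝ) ^ (-(1 + θ)) ≤ (p : ℝ) ^ (-(2 * θ)) :=
      Real.rpow_le_rpow_of_exponent_le (by linarith) (by linarith)
    have e3 : (p : ℝ) ^ (1 - θ) = (p : ℝ) ^ 2 * (p : ℝ) ^ (-(1 + θ)) := by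
      rw [← Real.rpow_natCast, ← Real.rpow_add hp0]
      congr 1
      push_cast
      ring
    have e4 : ((p ^ 2 : ℕ) : ℝ) ^ (1 - θ) = (p : ℝ) ^ 2 * (p : ℝ) ^ (-(2 * θ)) := by
      rw [Nat.cast_pow, ← Real.rpow_natCast, ← Real.rpow_mul hp0.le, ← Real.rpow_add hp0]
      congr 1
      push_cast
      ring
    have hpos : 0 ≤ (p : ℝ) ^ (-(2 * θ)) := by positivity
    rw [e1, e3, e4]
    split_ifs with h2
    · have h3 : (3 : ℝ) ≤ p := by exact_mod_cast h2
      have h3' : (0 : ℝ) < p - 2 := by linarith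
      have b : (p : ℝ) ^ 2 * (1 / (p * (p - 2))) ≤ 3 := by
        rw [mul_one_div, div_le_iff₀ (by positivity)]
        nlinarith
      rw [abs_of_pos (by positivity), neg_div, abs_neg, abs_of_pos (by positivity)]
      calc 2 / ((p : ℝ) * (p - 2)) * ((p : ℝ) ^ 2 * (p : ℝ) ^ (-(1 + θ)))
          + 1 / ((p : ℝ) * (p - 2)) * ((p : ℝ) ^ 2 * (p : ℝ) ^ (-(2 * θ)))
          = (p : ℝ) ^ 2 * (1 / (p * (p - 2))) *
            (2 * (p : ℝ) ^ (-(1 + θ)) + (p : ℝ) ^ (-(2 * θ))) := by ring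
        _ ≤ 3 * (2 * (p : ℝ) ^ (-(2 * θ)) + (p : ℝ) ^ (-(2 * θ))) := by gcongr
        _ = _ := by ring
    · have : p = 2 := le_antisymm (not_lt.1 h2) hp.two_le
      subst this
      rw [abs_zero, zero_mul, add_zero, abs_of_neg (by norm_num)]
      push_cast at e2 hpos ⊢
      linarith

lemma summable_singularKernel : Summable fun n : ℕ => singularKernel n := by
  refine Summable.of_norm_bounded
    (summable_abs_singularKernel_mul_rpow (θ := 3 / 4) (by norm_num) (by norm_num)) fun n => ?_
  rcases Nat.eq_zero_or_pos n with rfl | hn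
  · simp
  · have hn1 : (1 : ℝ) ≤ n := by exact_mod_cast hn
    exact le_mul_of_one_le_right (abs_nonneg _) (Real.one_le_rpow hn1 (by norm_num))

lemma summable_singularKernel_mul_log :
    Summable fun n : ℕ => |singularKernel n| * Real.log n := by
  refine Summable.of_nonneg_of_le
    (fun n => mul_nonneg (abs_nonneg _) (Real.log_natCast_nonneg n)) (fun n => ?_)
    ((summable_abs_singularKernel_mul_rpow (θ := 3 / 4) (by norm_num) (by norm_num)).mul_right
      (1 - 3 / 4)⁻¹)
  rw [mul_assoc]
  gcongr
  exact Real.log_le_rpow_div (Nat.cast_nonneg n) (by norm_num)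

lemma summable_singularKernel_mul_inv :
    Summable fun n : ℕ => singularKernel n * (n : ℝ)⁻¹ := by
  refine Summable.of_norm_bounded summable_singularKernel.norm fun n => ?_
  rw [norm_mul]
  refine mul_le_of_le_one_right (norm_nonneg _) ?_
  rw [norm_inv, Real.norm_natCast]
  exact Nat.cast_inv_le_one n

/-- The twin prime constant `∏_{p > 2} (1 - 1 / (p - 1) ^ 2)`. -/
noncomputable def twinPrimeConst : ℝ :=
  ∏' p : Nat.Primes, if 2 < (p : ℕ) then (1 - 1 / ((p : ℝ) - 1) ^ 2) else 1

lemma hasProd_twinPrimeConst :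
    HasProd (fun p : Nat.Primes => if 2 < (p : ℕ) then (1 - 1 / ((p : ℝ) - 1) ^ 2) else 1)
      twinPrimeConst := by
  apply Multipliable.hasProd
  have h : Summable fun p : Nat.Primes => (4 : ℝ) * (((p : ℕ) : ℝ) ^ 2)⁻¹ :=
    ((Real.summable_nat_pow_inv.2 one_lt_two).mul_left 4).comp_injective
      Nat.Primes.coe_nat_injective
  have h2 : Multipliable fun p : Nat.Primes =>
      1 + (if 2 < (p : ℕ) then - (1 / ((p : ℝ) - 1) ^ 2) else 0) := by
    apply multipliable_one_add_of_summable
    refine Summable.of_nonneg_of_le (fun p => norm_nonneg _) (fun p => ?_) h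
    split_ifs with hp
    · have hp' : (2 : ℝ) < (p : ℕ) := by exact_mod_cast hp
      have hp1 : (0 : ℝ) < ((p : ℕ) : ℝ) - 1 := by linarith
      rw [norm_neg, Real.norm_of_nonneg (by positivity), ← div_eq_mul_inv,
        div_le_div_iff₀ (by positivity) (by positivity)]
      nlinarith
    · simp only [norm_zero]
      positivity
  refine h2.congr fun p => ?_
  split_ifs <;> ring

lemma hasProd_singularKernel_mul {g : ℕ → ℝ} (hg1 : g 1 = 1)
    (hg : ∀ m n : ℕ, g (m * n) = g m * g n)
    (hs : Summable fun n : ℕ => singularKernel n * g n) :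
    HasProd (fun p : Nat.Primes => 1 + singularKernel (p : ℕ) * g p
        + singularKernel ((p : ℕ) ^ 2) * g ((p : ℕ) ^ 2))
      (∑' n : ℕ, singularKernel n * g n) := by
  have h := EulerProduct.eulerProduct_hasProd (f := fun n : ℕ => singularKernel n * g n)
    (by simp [singularKernel_one, hg1])
    (fun {m n} hmn => by rw [isMultiplicative_singularKernel.2 hmn, hg]; ring)
    hs.norm (by simp)
  have e : (fun p : Nat.Primes => 1 + singularKernel (p : ℕ) * g p
        + singularKernel ((p : ℕ) ^ 2) * g ((p : ℕ) ^ 2))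
      = fun p : Nat.Primes => ∑' k : ℕ, singularKernel ((p : ℕ) ^ k) * g ((p : ℕ) ^ k) := by
    funext p
    rw [(hasSum_prime_pow_of_eq_zero (w := fun n : ℕ => singularKernel n * g n) (p := p)
      fun k hk => by simp [singularKernel_prime_pow_eq_zero p.2 hk]).tsum_eq]
    simp [singularKernel_one, hg1]
  rw [e]
  exact h

lemma twinPrimeConst_mul_tsum_singularKernel :
    twinPrimeConst * ∑' n : ℕ, singularKernel n = 1 / 2 := by
  have h := hasProd_singularKernel_mul (g := fun _ => 1) rfl (by simp)
    (by simpa using summable_singularKernel)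
  simp only [mul_one] at h
  have h2 := hasProd_twinPrimeConst.mul h
  have h3 : HasProd (fun p : Nat.Primes => if (p : ℕ) = 2 then (1 / 2 : ℝ) else 1)
      (1 / 2) := by
    have := hasProd_single (f := fun p : Nat.Primes => if (p : ℕ) = 2 then (1 / 2 : ℝ) else 1)
      (⟨2, Nat.prime_two⟩ : Nat.Primes) fun p hp => if_neg fun h => hp (Subtype.ext h)
    simpa using this
  refine h2.unique (Eq.subst (motive := fun f => HasProd f (1 / 2)) (funext fun p => ?_) h3)
  symm
  rw [singularKernel_prime p.2, singularKernel_prime_sq p.2]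
  split_ifs with hp hp' hp'
  · lia
  · have hp' : (2 : ℝ) < (p : ℕ) := by exact_mod_cast hp
    have hp1 : ((p : ℕ) : ℝ) - 1 ≠ 0 := by linarith
    have hp2 : ((p : ℕ) : ℝ) - 2 ≠ 0 := by linarith
    field_simp
    ring
  · norm_num
  · exact absurd (le_antisymm (not_lt.1 hp) p.2.two_le) hp'

lemma twinPrimeConst_mul_tsum_singularKernel_mul_inv :
    twinPrimeConst * (∑' n : ℕ, singularKernel n * (n : ℝ)⁻¹) * ∑' n : ℕ, ((n : ℝ) ^ 2)⁻¹ = 1 := by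
  have h := hasProd_singularKernel_mul (g := fun n => (n : ℝ)⁻¹) (by simp)
    (by simp [mul_comm]) summable_singularKernel_mul_inv
  let f : ℕ →*₀ ℝ :=
    { toFun := fun n => ((n : ℝ) ^ 2)⁻¹
      map_zero' := by simp
      map_one' := by simp
      map_mul' := fun m n => by push_cast; rw [mul_pow, mul_inv] }
  have hz := EulerProduct.eulerProduct_completely_multiplicative_hasProd (f := f)
    (Real.summable_nat_pow_inv.2 one_lt_two).norm
  have h2 := (hasProd_twinPrimeConst.mul h).mul hz
  refine h2.unique (Eq.subst (motive := fun f => HasProd f 1) (funext fun p => ?_) hasProd_one)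
  symm
  change _ * (1 - (((p : ℕ) : ℝ) ^ 2)⁻¹)⁻¹ = 1
  rw [singularKernel_prime p.2, singularKernel_prime_sq p.2]
  split_ifs with hp
  · have hp' : (2 : ℝ) < (p : ℕ) := by exact_mod_cast hp
    have hp1 : ((p : ℕ) : ℝ) - 1 ≠ 0 := by linarith
    have hp2 : ((p : ℕ) : ℝ) - 2 ≠ 0 := by linarith
    have hp3 : ((p : ℕ) : ℝ) ^ 2 - 1 ≠ 0 := by nlinarith
    push_cast
    field_simp
    ring
  · rw [le_antisymm (not_lt.1 hp) p.2.two_le]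
    norm_num

lemma hasSum_singularKernel_mul_factorization (φ : ℕ → ℝ) {p : ℕ} (hp : p.Prime) :
    HasSum (fun n : ℕ => singularKernel n * φ (n.factorization p))
      ((φ 0 + φ 1 * singularKernel p + φ 2 * singularKernel (p ^ 2))
        * ∑' n : ℕ, if p ∣ n then 0 else singularKernel n) := by
  have hs : Summable fun n : ℕ => if p ∣ n then 0 else singularKernel n := by
    refine Summable.of_norm_bounded summable_singularKernel.norm fun n => ?_
    split_ifs <;> simp
  set A := ∑' n : ℕ, if p ∣ n then 0 else singularKernel n with hA
  have hk : ∀ k : ℕ, HasSum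
      (fun n : ℕ => if n ≠ 0 ∧ n.factorization p = k then singularKernel n * φ k else 0)
      (φ k * singularKernel (p ^ k) * A) := by
    intro k
    have hinj : Function.Injective fun m : ℕ => p ^ k * m :=
      fun a b h => Nat.eq_of_mul_eq_mul_left (pow_pos hp.pos k) h
    rw [← hinj.hasSum_iff]
    · refine Eq.subst (motive := fun f => HasSum f (φ k * singularKernel (p ^ k) * A))
        (funext fun m => ?_) (hs.hasSum.mul_left (φ k * singularKernel (p ^ k)))
      symm
      simp only [Function.comp]
      by_cases hm : p ∣ m
      · rw [if_pos hm, if_neg, mul_zero]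
        rintro ⟨hne, hf⟩
        have hm0 : m ≠ 0 := right_ne_zero_of_mul hne
        rw [Nat.factorization_mul (pow_ne_zero _ hp.ne_zero) hm0, hp.factorization_pow] at hf
        have := (hp.dvd_iff_one_le_factorization hm0).1 hm
        simp at hf
        lia
      · have hm0 : m ≠ 0 := by rintro rfl; exact hm (dvd_zero _)
        have hcop : (p ^ k).Coprime m := ((Nat.Prime.coprime_iff_not_dvd hp).2 hm).pow_left k
        rw [if_neg hm, if_pos, isMultiplicative_singularKernel.2 hcop]
        · ring
        · refine ⟨mul_ne_zero (pow_ne_zero _ hp.ne_zero) hm0, ?_⟩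
          rw [Nat.factorization_mul (pow_ne_zero _ hp.ne_zero) hm0, hp.factorization_pow]
          simp [Nat.factorization_eq_zero_of_not_dvd hm]
    · intro n hn
      rw [if_neg]
      rintro ⟨hn0, rfl⟩
      exact hn ⟨_, Nat.ordProj_mul_ordCompl_eq_self n p⟩
  have h := ((hk 0).add (hk 1)).add (hk 2)
  convert h using 1
  · ext n
    by_cases hn : n = 0
    · simp [hn]
    · by_cases h3 : 3 ≤ n.factorization p
      · have hz : singularKernel n = 0 := by
          rw [isMultiplicative_singularKernel.multiplicative_factorization _ hn]
          refine Finset.prod_eq_zero (i := p) ?_ (singularKernel_prime_pow_eq_zero hp h3)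
          rw [Finsupp.mem_support_iff]
          lia
        simp [hz]
      · have : n.factorization p < 3 := not_le.1 h3
        interval_cases h : n.factorization p <;> simp [hn]
  · simp [singularKernel_one]
    ring

lemma tsum_singularKernel_mul_log :
    ∑' n : ℕ, singularKernel n * Real.log n = -(Real.log 2 * ∑' n : ℕ, singularKernel n) := by
  let F : ℕ → ℕ → ℝ := fun n p => singularKernel n * (n.factorization p * Real.log p)
  have hF : ∀ n, HasSum (F n) (singularKernel n * Real.log n) := by
    intro n
    rw [Real.log_nat_eq_sum_factorization]
    refine HasSum.mul_left _ (hasSum_sum_of_ne_finset_zero fun p hp => ?_)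
    rw [Finsupp.notMem_support_iff.1 hp]
    simp
  have hFn : ∀ n, HasSum (fun p => ‖F n p‖) (|singularKernel n| * Real.log n) := by
    intro n
    rw [Real.log_nat_eq_sum_factorization]
    have : ∀ p, ‖F n p‖ = |singularKernel n| * (n.factorization p * Real.log p) := fun p => by
      rw [norm_mul, Real.norm_eq_abs, Real.norm_of_nonneg]
      exact mul_nonneg (Nat.cast_nonneg _) (Real.log_natCast_nonneg p)
    simp_rw [this]
    refine HasSum.mul_left _ (hasSum_sum_of_ne_finset_zero fun p hp => ?_)
    rw [Finsupp.notMem_support_iff.1 hp]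
    simp
  have hsum : Summable (Function.uncurry F) := by
    apply Summable.of_norm
    rw [summable_prod_of_nonneg fun _ => norm_nonneg _]
    refine ⟨fun n => (hFn n).summable, ?_⟩
    convert summable_singularKernel_mul_log using 2 with n
    exact (hFn n).tsum_eq
  have hcol : ∀ p, ∑' n, F n p = if p = 2 then -(Real.log 2 * ∑' n : ℕ, singularKernel n) else 0 := by
    intro p
    by_cases hp : p.Prime
    · have h1 := hasSum_singularKernel_mul_factorization (fun k => k) hp
      have e : ∀ n, F n p = singularKernel n * (n.factorization p : ℝ) * Real.log p := fun n => by
        simp only [F]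
        ring
      simp_rw [e]
      rw [tsum_mul_right, h1.tsum_eq, singularKernel_prime hp, singularKernel_prime_sq hp]
      split_ifs with h2 h3 h3
      · lia
      · have h2' : (2 : ℝ) < p := by exact_mod_cast h2
        have h3 : (p : ℝ) - 2 ≠ 0 := by linarith
        push_cast
        ring
      · have h0 := hasSum_singularKernel_mul_factorization (fun _ => 1) hp
        simp only [mul_one] at h0
        rw [h0.tsum_eq, singularKernel_prime hp, singularKernel_prime_sq hp, h3]
        norm_num
        ring
      · exact absurd (le_antisymm (not_lt.1 h2) hp.two_le) h3
    · rw [if_neg (by rintro rfl; exact hp Nat.prime_two)]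
      simp [F, Nat.factorization_eq_zero_of_not_prime _ hp]
  calc ∑' n : ℕ, singularKernel n * Real.log n = ∑' n, ∑' p, F n p :=
        tsum_congr fun n => (hF n).tsum_eq.symm
    _ = ∑' p, ∑' n, F n p := hsum.tsum_comm.symm
    _ = _ := by
      simp_rw [hcol]
      exact tsum_ite_eq 2 _

lemma sum_Ioc_mul_convolution (f g : ArithmeticFunction ℝ) (φ : ℕ → ℝ) {M : ℕ}
    (hφ : ∀ m, M < m → φ m = 0) :
    ∑ n ∈ Ioc 0 M, φ n * (f * g) n
      = ∑ a ∈ Ioc 0 M, f a * ∑ b ∈ Ioc 0 M, φ (a * b) * g b := by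
  have h : ∀ n ∈ Ioc 0 M, φ n * (f * g) n
      = ∑ x ∈ Ioc 0 M ×ˢ Ioc 0 M, if x.1 * x.2 = n then φ (x.1 * x.2) * (f x.1 * g x.2) else 0 := by
    intro n hn
    rw [mem_Ioc] at hn
    rw [mul_apply, Nat.divisorsAntidiagonal_eq_prod_filter_of_le hn.1.ne' hn.2, ← sum_filter,
      mul_sum]
    exact sum_congr rfl fun x hx => by rw [(mem_filter.1 hx).2]
  rw [sum_congr rfl h, sum_comm, sum_product]
  refine sum_congr rfl fun a ha => ?_
  rw [mul_sum]
  refine sum_congr rfl fun b hb => ?_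
  rw [sum_ite_eq]
  rw [mem_Ioc] at ha hb
  split_ifs with hab
  · ring
  · rw [hφ (a * b)]
    · ring
    · by_contra hlt
      exact hab (mem_Ioc.2 ⟨Nat.mul_pos ha.1 hb.1, not_lt.1 hlt⟩)

lemma sum_max_mul_singularFactor_eq {x : ℝ} {M : ℕ} (hM : x ≤ M) :
    ∑ n ∈ Ioc 0 M, max 0 (x - n) * singularFactor n
      = ∑ a ∈ Ioc 0 M, singularKernel a *
        (a * ∑ b ∈ Ioc 0 M, ∑ k ∈ Ioc 0 M, max 0 (x / a / b - k)) := by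
  rw [← singularKernel_mul_eq, sum_Ioc_mul_convolution]
  · refine sum_congr rfl fun a ha => ?_
    rw [mem_Ioc] at ha
    have ha0 : (0 : ℝ) < a := by exact_mod_cast ha.1
    congr 1
    rw [sum_Ioc_mul_convolution _ _ fun b => max 0 (x - (a * b : ℕ)), mul_sum]
    · refine sum_congr rfl fun b hb => ?_
      rw [mem_Ioc] at hb
      have hb0 : (0 : ℝ) < b := by exact_mod_cast hb.1
      rw [mul_sum, mul_sum]
      refine sum_congr rfl fun k hk => ?_
      rw [mem_Ioc] at hk
      rw [invId_apply, natCoe_apply, zeta_apply_ne hk.1.ne', Nat.cast_one, mul_one,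
        mul_max_of_nonneg _ _ (inv_nonneg.2 hb0.le), mul_max_of_nonneg _ _ ha0.le]
      congr 1
      · ring
      · push_cast
        field_simp
    · intro m hm
      refine max_eq_left ?_
      have : (M : ℝ) ≤ (a * m : ℕ) := by
        exact_mod_cast hm.le.trans (Nat.le_mul_of_pos_left m ha.1)
      linarith
  · intro m hm
    refine max_eq_left ?_
    have : (M : ℝ) ≤ m := by exact_mod_cast hm.le
    linarith

lemma sum_max_mul_eq_sum_floor {x : ℝ} (hx : 0 ≤ x) {M : ℕ} (hM : x ≤ M) (w : ℕ → ℝ) :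
    ∑ n ∈ Ioc 0 M, max 0 (x - n) * w n = ∑ n ∈ Ioc 0 ⌊x⌋₊, (x - n) * w n := by
  rw [← sum_subset (Ioc_subset_Ioc_right (Nat.floor_le_of_le hM))]
  · refine sum_congr rfl fun n hn => ?_
    rw [max_eq_right]
    exact sub_nonneg.2 ((Nat.le_floor_iff hx).1 (mem_Ioc.1 hn).2)
  · intro n hn hn'
    rw [mem_Ioc] at hn hn'
    have : x < n := (Nat.floor_lt hx).1 (by lia)
    rw [max_eq_left (by linarith), zero_mul]

lemma exists_abs_sum_sum_max_sub_le {θ : ℝ} (hθ : 1 / 2 < θ) (hθ1 : θ < 1) :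
    ∃ C : ℝ, ∀ X : ℝ, 0 < X → ∀ M : ℕ, ⌊X⌋₊ ≤ M →
      |∑ b ∈ Ioc 0 M, ∑ k ∈ Ioc 0 M, max 0 (X / b - k)
        - ((∑' b : ℕ, ((b : ℝ) ^ 2)⁻¹) * X ^ 2 / 2 - X * Real.log X / 2
          + (1 - Real.eulerMascheroniConstant - Real.log (2 * π)) / 2 * X)| ≤ C * X ^ θ := by
  set Z : ℝ := ∑' b : ℕ, ((b : ℝ) ^ 2)⁻¹ with hZ
  set κ : ℝ := (1 - Real.eulerMascheroniConstant - Real.log (2 * π)) / 2 with hκ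
  have hZ0 : 0 ≤ Z := tsum_nonneg fun b => by positivity
  have hd : 0 < 1 / (1 - θ) := one_div_pos.2 (by linarith)
  refine ⟨120 + (Z + 1 / (1 - θ)) + |κ|, fun X hX M hM => ?_⟩
  have hXθ : 0 < X ^ θ := Real.rpow_pos_of_pos hX θ
  rcases le_or_gt 1 X with h1 | h1
  · refine (abs_sum_sum_max_sub_le h1 hM).trans ?_
    have h2 : √X ≤ X ^ θ := by
      rw [Real.sqrt_eq_rpow]
      exact Real.rpow_le_rpow_of_exponent_le h1 hθ.le
    have h3 : 0 ≤ (Z + 1 / (1 - θ) + |κ|) * X ^ θ := by positivity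
    nlinarith
  · have h0 : ∑ b ∈ Ioc 0 M, ∑ k ∈ Ioc 0 M, max 0 (X / b - k) = 0 := by
      refine sum_eq_zero fun b hb => sum_eq_zero fun k hk => max_eq_left ?_
      have hb1 : (1 : ℝ) ≤ b := by exact_mod_cast (mem_Ioc.1 hb).1
      have hk1 : (1 : ℝ) ≤ k := by exact_mod_cast (mem_Ioc.1 hk).1
      have := div_le_self hX.le hb1
      linarith
    have hle : X ≤ X ^ θ := by
      simpa using Real.rpow_le_rpow_of_exponent_ge hX h1.le hθ1.le
    have hlog : |X * Real.log X| ≤ 1 / (1 - θ) * X ^ θ := by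
      have h2 := (Real.abs_log_mul_self_rpow_lt X (1 - θ) hX h1.le (by linarith)).le
      have h3 : X * Real.log X = Real.log X * X ^ (1 - θ) * X ^ θ := by
        rw [mul_assoc, ← Real.rpow_add hX, sub_add_cancel, Real.rpow_one, mul_comm]
      rw [h3, abs_mul, abs_of_pos hXθ]
      gcongr
    have hκX : |κ * X| ≤ |κ| * X ^ θ := by
      rw [abs_mul, abs_of_pos hX]
      gcongr
    have hZX : Z * X ^ 2 ≤ Z * X ^ θ := by
      gcongr
      nlinarith
    have hZX0 : 0 ≤ Z * X ^ 2 := by positivity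
    have hpos : 0 ≤ Z * X ^ θ := by positivity
    rw [h0]
    rw [abs_le] at hlog hκX ⊢
    constructor <;> nlinarith

lemma tendsto_sum_Ioc_of_hasSum {f : ℕ → ℝ} {s : ℝ} (h0 : f 0 = 0) (h : HasSum f s) :
    Filter.Tendsto (fun M : ℕ => ∑ n ∈ Ioc 0 M, f n) Filter.atTop (nhds s) := by
  refine ((Filter.tendsto_add_atTop_iff_nat 1).2 h.tendsto_sum_nat).congr fun M => ?_
  rw [Nat.range_succ_eq_Icc_zero, Icc_eq_cons_Ioc (Nat.zero_le M), sum_cons, h0, zero_add]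

lemma exists_abs_sum_singularFactor_sub_le {θ : ℝ} (hθ : 1 / 2 < θ) (hθ1 : θ < 1) :
    ∃ C : ℝ, ∀ x : ℝ, 0 < x →
      |4 * twinPrimeConst * ∑ n ∈ Ioc 0 ⌊x⌋₊, (x - n) * singularFactor n
        - (2 * x ^ 2 - x * Real.log x - x * Real.log 2
          + (1 - Real.eulerMascheroniConstant - Real.log (2 * π)) * x)| ≤ C * x ^ θ := by
  obtain ⟨C, hC⟩ := exists_abs_sum_sum_max_sub_le hθ hθ1
  have hA := twinPrimeConst_mul_tsum_singularKernel_mul_inv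
  have hB := twinPrimeConst_mul_tsum_singularKernel
  have hsA := summable_singularKernel_mul_inv.hasSum
  have hsB := summable_singularKernel.hasSum
  have hsL : HasSum (fun n : ℕ => singularKernel n * Real.log n)
      (-(Real.log 2 * ∑' n : ℕ, singularKernel n)) := by
    rw [← tsum_singularKernel_mul_log]
    refine (Summable.of_norm ?_).hasSum
    refine summable_singularKernel_mul_log.congr fun n => ?_
    rw [norm_mul, Real.norm_eq_abs, Real.norm_of_nonneg (Real.log_natCast_nonneg n)]
  set Z : ℝ := ∑' b : ℕ, ((b : ℝ) ^ 2)⁻¹ with hZ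
  set A : ℝ := ∑' n : ℕ, singularKernel n * (n : ℝ)⁻¹
  set B : ℝ := ∑' n : ℕ, singularKernel n
  set κ : ℝ := (1 - Real.eulerMascheroniConstant - Real.log (2 * π)) / 2 with hκ
  have hsW := summable_abs_singularKernel_mul_rpow hθ hθ1
  set W : ℝ := ∑' n : ℕ, |singularKernel n| * (n : ℝ) ^ (1 - θ)
  have hC0 : 0 ≤ C := by
    have h := (abs_nonneg _).trans (hC 1 one_pos _ le_rfl)
    simpa using h
  refine ⟨4 * |twinPrimeConst| * (C * W), fun x hx => ?_⟩
  have hxθ : 0 < x ^ θ := Real.rpow_pos_of_pos hx θ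
  let main : ℕ → ℝ := fun a => Z * (x / a) ^ 2 / 2 - x / a * Real.log (x / a) / 2 + κ * (x / a)
  have hmain : HasSum (fun a : ℕ => singularKernel a * (a * main a))
      (Z * x ^ 2 / 2 * A + (κ * x - x * Real.log x / 2) * B + x / 2 * -(Real.log 2 * B)) := by
    refine Eq.subst (motive := fun f => HasSum f _) (funext fun a => ?_)
      (((hsA.mul_left (Z * x ^ 2 / 2)).add (hsB.mul_left (κ * x - x * Real.log x / 2))).add
        (hsL.mul_left (x / 2)))
    rcases Nat.eq_zero_or_pos a with rfl | ha
    · simp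
    · have ha0 : (0 : ℝ) < a := by exact_mod_cast ha
      simp only [main]
      rw [Real.log_div hx.ne' ha0.ne']
      field_simp
      ring
  have hlim := tendsto_sum_Ioc_of_hasSum (by simp) hmain
  have hbound : ∀ᶠ M : ℕ in Filter.atTop,
      |∑ n ∈ Ioc 0 ⌊x⌋₊, (x - n) * singularFactor n
        - ∑ a ∈ Ioc 0 M, singularKernel a * (a * main a)| ≤ C * W * x ^ θ := by
    filter_upwards [Filter.eventually_ge_atTop ⌈x⌉₊] with M hM
    have hxM : x ≤ M := Nat.ceil_le.1 hM
    rw [← sum_max_mul_eq_sum_floor hx.le hxM, sum_max_mul_singularFactor_eq hxM,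
      ← sum_sub_distrib]
    calc _ ≤ ∑ a ∈ Ioc 0 M, C * x ^ θ * (|singularKernel a| * (a : ℝ) ^ (1 - θ)) := by
          refine (abs_sum_le_sum_abs _ _).trans (sum_le_sum fun a ha => ?_)
          have ha1 : (1 : ℝ) ≤ a := by exact_mod_cast (mem_Ioc.1 ha).1
          have ha0 : (0 : ℝ) < a := by linarith
          have hfl : ⌊x / a⌋₊ ≤ M := Nat.floor_le_of_le ((div_le_self hx.le ha1).trans hxM)
          have h := hC (x / a) (div_pos hx ha0) M hfl
          rw [← mul_sub, ← mul_sub, abs_mul, abs_mul, abs_of_pos ha0]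
          calc _ ≤ |singularKernel a| * (a * (C * (x / a) ^ θ)) := by gcongr
            _ = _ := by
              rw [Real.div_rpow hx.le ha0.le, Real.rpow_sub ha0, Real.rpow_one]
              ring
      _ = C * x ^ θ * ∑ a ∈ Ioc 0 M, |singularKernel a| * (a : ℝ) ^ (1 - θ) := by
          rw [mul_sum]
      _ ≤ C * x ^ θ * W := by
          gcongr
          exact hsW.sum_le_tsum _ fun n _ => by positivity
      _ = _ := by ring
  have hfin := le_of_tendsto ((tendsto_const_nhds.sub hlim).abs) hbound
  have e : 4 * twinPrimeConst * ∑ n ∈ Ioc 0 ⌊x⌋₊, (x - n) * singularFactor n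
        - (2 * x ^ 2 - x * Real.log x - x * Real.log 2
          + (1 - Real.eulerMascheroniConstant - Real.log (2 * π)) * x)
      = 4 * twinPrimeConst * (∑ n ∈ Ioc 0 ⌊x⌋₊, (x - n) * singularFactor n
        - (Z * x ^ 2 / 2 * A + (κ * x - x * Real.log x / 2) * B
          + x / 2 * -(Real.log 2 * B))) := by
    have hκ2 : 1 - Real.eulerMascheroniConstant - Real.log (2 * π) = 2 * κ := by
      rw [hκ]
      ring
    rw [hκ2]
    linear_combination 2 * x ^ 2 * hA
      + 4 * (κ * x - x * Real.log x / 2 - x / 2 * Real.log 2) * hB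
  rw [e, abs_mul, abs_mul, abs_of_pos (by norm_num : (0 : ℝ) < 4)]
  calc _ ≤ 4 * |twinPrimeConst| * (C * W * x ^ θ) := by gcongr
    _ = _ := by ring

end SingularSeriesKernel

section FinalAsymptotic

open Finset

lemma singularSeries_two_mul {m : ℕ} (hm : m ≠ 0) :
    singularSeries (2 * m) = 2 * twinPrimeConst * singularFactor m := by
  rw [singularSeries, if_pos (even_two_mul m), twinPrimeConst, singularFactor,
    ArithmeticFunction.prodPrimeFactors_apply hm, prod_filter, Nat.primeFactors_mul two_ne_zero hm,
    Nat.prime_two.primeFactors]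
  congr 1
  by_cases h2 : 2 ∈ m.primeFactors
  · rw [union_eq_right.2 (singleton_subset_iff.2 h2)]
  · rw [singleton_union, prod_insert h2]
    simp

lemma singularSeries_two_mul_add_one (m : ℕ) : singularSeries (2 * m + 1) = 0 := by
  rw [singularSeries, if_neg]
  simp

lemma sum_Ioc_mul_singularSeries (φ : ℕ → ℝ) (n : ℕ) :
    ∑ h ∈ Ioc 0 n, φ h * singularSeries h
      = 2 * twinPrimeConst * ∑ m ∈ Ioc 0 (n / 2), φ (2 * m) * singularFactor m := by
  induction n with
  | zero => simp
  | succ n ih =>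
    rw [sum_Ioc_succ_top (Nat.zero_le n), ih]
    rcases Nat.even_or_odd' n with ⟨m, rfl | rfl⟩
    · have e : (2 * m + 1) / 2 = 2 * m / 2 := by lia
      rw [singularSeries_two_mul_add_one, e]
      ring
    · have e : (2 * m + 1 + 1) / 2 = m + 1 := by lia
      have e2 : (2 * m + 1) / 2 = m := by lia
      rw [show 2 * m + 1 + 1 = 2 * (m + 1) by ring, singularSeries_two_mul m.succ_ne_zero,
        Nat.mul_div_cancel_left _ two_pos, e2, sum_Ioc_succ_top (Nat.zero_le m)]
      ring

lemma sum_sub_mul_singularSeries (y : ℝ) :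
    ∑ h ∈ Icc 1 ⌊y⌋₊, (y - h) * singularSeries h
      = 4 * twinPrimeConst * ∑ m ∈ Ioc 0 ⌊y / 2⌋₊, (y / 2 - m) * singularFactor m := by
  have h := sum_Ioc_mul_singularSeries (fun h => y - h) ⌊y⌋₊
  have e : ⌊y / 2⌋₊ = ⌊y⌋₊ / 2 := by exact_mod_cast Nat.floor_div_natCast y 2
  rw [show Icc 1 ⌊y⌋₊ = Ioc 0 ⌊y⌋₊ from rfl, h, e, mul_sum, mul_sum]
  refine sum_congr rfl fun m _ => ?_
  push_cast
  ring

lemma sum_Icc_zero_ite (c : ℕ → ℝ) (n : ℕ) :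
    ∑ k ∈ Icc 0 n, (if k = 0 then 0 else c k) = ∑ k ∈ Icc 1 n, c k := by
  rw [Icc_eq_cons_Ioc (Nat.zero_le n), sum_cons, if_pos rfl, zero_add]
  exact sum_congr rfl fun k hk => if_neg (mem_Ioc.1 hk).1.ne'

lemma intervalIntegrable_sum_Icc_floor (c : ℕ → ℝ) {y : ℝ} (hy : 1 ≤ y) :
    IntervalIntegrable (fun t : ℝ => ∑ k ∈ Icc 1 ⌊t⌋₊, c k) volume 1 y := by
  rw [intervalIntegrable_iff_integrableOn_Icc_of_le hy]
  have h := integrableOn_mul_sum_Icc (𝕜 := ℝ) (a := 1) (b := y) (m := 1) c zero_le_one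
    (g := fun _ => 1) (by simp)
  simpa using h

lemma integral_sum_Icc_floor (c : ℕ → ℝ) {y : ℝ} (hy : 1 ≤ y) :
    ∫ t in (1 : ℝ)..y, ∑ k ∈ Icc 1 ⌊t⌋₊, c k = ∑ k ∈ Icc 1 ⌊y⌋₊, (y - k) * c k := by
  have h := sum_mul_eq_sub_integral_mul₀ (𝕜 := ℝ) (f := fun t => t)
    (fun k => if k = 0 then 0 else c k) (by simp) y (fun t _ => differentiableAt_id)
    (by simp)
  simp only [deriv_id'', one_mul, mul_ite, mul_zero, sum_Icc_zero_ite] at h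
  rw [← intervalIntegral.integral_of_le hy] at h
  simp only [sub_mul, sum_sub_distrib, ← mul_sum]
  linarith

lemma integral_epsErr {y : ℝ} (hy : 1 ≤ y) :
    ∫ u in (1 : ℝ)..y, epsErr u
      = ∑ k ∈ Icc 1 ⌊y⌋₊, (y - k) * singularSeries k - (y ^ 2 - 1) / 2
        + (y * Real.log y - y + 1) / 2 := by
  have h1 := intervalIntegrable_sum_Icc_floor singularSeries hy
  have h2 : IntervalIntegrable (fun u : ℝ => u) volume 1 y := intervalIntegral.intervalIntegrable_id
  have h3 : IntervalIntegrable (fun u : ℝ => Real.log u / 2) volume 1 y :=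
    intervalIntegral.intervalIntegrable_log'.div_const 2
  simp only [epsErr]
  rw [intervalIntegral.integral_add (h1.sub h2) h3, intervalIntegral.integral_sub h1 h2,
    integral_sum_Icc_floor _ hy, integral_id, intervalIntegral.integral_div, integral_log, Real.log_one]
  ring

end FinalAsymptotic

/-- Lemma 2.2: for any `ε > 0`, `∫_1^y ε(u) du = (B/2) y + O(y^(1/2+ε))`, where
`B = -C₀ - log 2π`. -/
theorem integral_epsErr_asymptotic (ε : ℝ) (hε : 0 < ε) :
    ∃ C : ℝ, 0 < C ∧ ∀ y : ℝ, 1 ≤ y →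
      |(∫ u in (1 : ℝ)..y, epsErr u) - Bconst / 2 * y| ≤ C * y ^ ((1 : ℝ) / 2 + ε) := by
  set δ := min ε (1 / 4) with hδ
  have hδ0 : 0 < δ := lt_min hε (by norm_num)
  have hδ1 : δ ≤ 1 / 4 := min_le_right _ _
  obtain ⟨C, hC⟩ := exists_abs_sum_singularFactor_sub_le (θ := 1 / 2 + δ) (by linarith)
    (by linarith)
  refine ⟨|C| + 1, by positivity, fun y hy => ?_⟩
  have hy0 : 0 < y := by linarith
  have h := hC (y / 2) (by linarith)
  rw [← sum_sub_mul_singularSeries, Real.log_div hy0.ne' two_ne_zero] at h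
  have hle : (y / 2) ^ (1 / 2 + δ) ≤ y ^ ((1 : ℝ) / 2 + ε) :=
    (Real.rpow_le_rpow (by linarith) (by linarith) (by linarith)).trans
      (Real.rpow_le_rpow_of_exponent_le hy (by linarith [min_le_left ε (1 / 4)]))
  have hone : 1 ≤ y ^ ((1 : ℝ) / 2 + ε) := Real.one_le_rpow hy (by linarith)
  have e : (∫ u in (1 : ℝ)..y, epsErr u) - Bconst / 2 * y
      = (∑ k ∈ Finset.Icc 1 ⌊y⌋₊, (y - k) * singularSeries k
        - (2 * (y / 2) ^ 2 - y / 2 * (Real.log y - Real.log 2) - y / 2 * Real.log 2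
          + (1 - Real.eulerMascheroniConstant - Real.log (2 * π)) * (y / 2))) + 1 := by
    rw [integral_epsErr hy, Bconst]
    ring
  rw [e]
  calc _ ≤ C * (y / 2) ^ (1 / 2 + δ) + |(1 : ℝ)| := (abs_add_le _ _).trans (by gcongr)
    _ ≤ |C| * y ^ ((1 : ℝ) / 2 + ε) + y ^ ((1 : ℝ) / 2 + ε) := by
      rw [abs_one]
      refine add_le_add (mul_le_mul (le_abs_self C) hle (by positivity) (abs_nonneg C)) hone
    _ = _ := by ring
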